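/- Let A and B be symmetric real n×n matrices. Then ⟨A⁴B + A³BA + A²BA² + ABA³ + BA⁴ : B⟩ = |A²B + ABA|² + |A²B|². In particular this quantity is ≥ |A²B|². -/

import Mathlib

open Matrix

/-- The Frobenius inner product `⟨A : B⟩ = tr(Aᵀ B)`. -/
noncomputable def mip {n : ℕ} (A B : Matrix (Fin n) (Fin n) ℝ) : ℝ :=
  (Aᵀ * B).trace

theorem mip_self_nonneg {n : ℕ} (M : Matrix (Fin n) (Fin n) ℝ) : 0 ≤ mip M M := by
  simpa [mip] using (Matrix.posSemidef_conjTranspose_mul_self M).trace_nonneg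

theorem stmt_9 {n : ℕ} (A B : Matrix (Fin n) (Fin n) ℝ) (hA : Aᵀ = A) (hB : Bᵀ = B) :
    (mip (A ^ 4 * B + A ^ 3 * B * A + A ^ 2 * B * A ^ 2 + A * B * A ^ 3 + B * A ^ 4) B
        = mip (A ^ 2 * B + A * B * A) (A ^ 2 * B + A * B * A) + mip (A ^ 2 * B) (A ^ 2 * B))
    ∧ mip (A ^ 2 * B) (A ^ 2 * B)
        ≤ mip (A ^ 4 * B + A ^ 3 * B * A + A ^ 2 * B * A ^ 2 + A * B * A ^ 3 + B * A ^ 4) B := by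
  have key : mip (A ^ 4 * B + A ^ 3 * B * A + A ^ 2 * B * A ^ 2 + A * B * A ^ 3 + B * A ^ 4) B
      = mip (A ^ 2 * B + A * B * A) (A ^ 2 * B + A * B * A) + mip (A ^ 2 * B) (A ^ 2 * B) := by
    have h₁ : (B * A ^ 4 * B).trace = (A ^ 4 * B * B).trace := by
      rw [trace_mul_comm, ← mul_assoc, trace_mul_comm, ← mul_assoc]
    have h₂ : (A * B * A ^ 3 * B).trace = (A ^ 3 * B * A * B).trace := by
      rw [mul_assoc (A * B), trace_mul_comm, ← mul_assoc]
    have h₃ : (B * A ^ 3 * B * A).trace = (A ^ 3 * B * A * B).trace := by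
      rw [mul_assoc, mul_assoc, trace_mul_comm, ← mul_assoc]
    have h₄ : (A * B * A ^ 2 * B * A).trace = (A ^ 2 * B * A ^ 2 * B).trace := by
      rw [mul_assoc (A * B * A ^ 2), mul_assoc (A * B), trace_mul_comm]
      simp only [pow_succ, pow_zero, one_mul, mul_assoc]
    simp only [mip, transpose_add, transpose_mul, hA, hB, add_mul, mul_add,
      trace_add, pow_succ, pow_zero, one_mul, mul_assoc] at h₁ h₂ h₃ h₄ ⊢
    linarith
  exact ⟨key, key ▸ le_add_of_nonneg_left (mip_self_nonneg _)⟩
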